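/- Let d ≥ 1, τ > 0, κ > 0, and let φ : ℝ^d → ℝ be a continuous κ-strongly convex function. Then for every y ∈ ℝ^d the integral ∫_{ℝ^d} exp(−|y−z|²/(2τ) − φ(z)) dz is finite and positive, and the function G(y) := −log ∫_{ℝ^d} exp(−|y−z|²/(2τ) − φ(z)) dz is (κ/(1+τκ))-strongly convex on ℝ^d. (This is the single-step preservation of strong log-concavity under Gaussian smoothing used in the proof that the Wasserstein flow preserves log-concavity over a fixed time horizon.) -/

import Mathlib

open MeasureTheory

/-- `f` is `α`-strongly convex on `ℝ^d`: `f - (α/2)‖·‖²` is convex. -/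
def IsStronglyConvex {d : ℕ} (α : ℝ) (f : EuclideanSpace ℝ (Fin d) → ℝ) : Prop :=
  ConvexOn ℝ Set.univ (fun x => f x - α / 2 * ‖x‖ ^ 2)

open scoped ENNReal Pointwise

theorem sSup_Iio_self (a : ℝ≥0∞) : a = sSup (Set.Iio a) := by
  refine le_antisymm (le_of_forall_lt fun c hc => ?_) (sSup_le fun b hb => le_of_lt hb)
  obtain ⟨d, h1, h2⟩ := exists_between hc
  exact lt_sSup_iff.2 ⟨d, h2, h1⟩

theorem vol_affine_image (r v : ℝ) (hr : 0 ≤ r) (K : Set ℝ) :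
    volume ((fun x => r * x + v) '' K) = ENNReal.ofReal r * volume K := by
  have : (fun x => r * x + v) '' K = v +ᵥ (r • K) := by
    ext x
    simp [Set.mem_smul_set, Set.mem_vadd_set, add_comm]
  rw [this, measure_vadd, Measure.addHaar_smul]
  simp [abs_of_nonneg hr]

theorem bm_compact (s t : ℝ) (hs : 0 ≤ s) (ht : 0 ≤ t) (K L C : Set ℝ)
    (hK : IsCompact K) (hL : IsCompact L) (hK0 : K.Nonempty) (hL0 : L.Nonempty)
    (hC : ∀ x ∈ K, ∀ y ∈ L, s * x + t * y ∈ C) :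
    ENNReal.ofReal s * volume K + ENNReal.ofReal t * volume L ≤ volume C := by
  obtain ⟨a, haK, ha⟩ := hK.exists_isGreatest hK0
  obtain ⟨b, hbL, hb⟩ := hL.exists_isLeast hL0
  rw [← vol_affine_image s (t * b) hs K, ← vol_affine_image t (s * a) ht L]
  rw [← measure_union₀]
  · apply measure_mono
    rintro _ (⟨x, hx, rfl⟩ | ⟨y, hy, rfl⟩)
    · exact hC x hx b hbL
    · simpa [add_comm] using hC a haK y hy
  · exact (hL.image (by fun_prop)).measurableSet.nullMeasurableSet
  · refine measure_mono_null (t := {s * a + t * b}) ?_ (by simp)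
    rintro z ⟨⟨x, hx, rfl⟩, ⟨y, hy, hxy⟩⟩
    have h1 := mul_le_mul_of_nonneg_left (ha hx) hs
    have h2 := mul_le_mul_of_nonneg_left (hb hy) ht
    simp only [Set.mem_singleton_iff] at *
    linarith

theorem exists_compact_approx (A : Set ℝ) (hA : MeasurableSet A) (c : ℝ≥0∞)
    (r : ℝ≥0∞) (hr : r < c * volume A) (hc : c ≠ ∞) :
    ∃ K ⊆ A, IsCompact K ∧ K.Nonempty ∧ r < c * volume K := by
  have hc0 : c ≠ 0 := by rintro rfl; simp at hr
  have : r / c < volume A := by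
    rw [ENNReal.div_lt_iff (Or.inl hc0) (Or.inl hc)]; rwa [mul_comm]
  obtain ⟨K, hKA, hK, hrK⟩ := hA.exists_lt_isCompact this
  refine ⟨K, hKA, hK, ?_, ?_⟩
  · rw [Set.nonempty_iff_ne_empty]; rintro rfl; simp at hrK
  · rw [ENNReal.div_lt_iff (Or.inl hc0) (Or.inl hc)] at hrK; rwa [mul_comm]

theorem bm_one (s t : ℝ) (hs : 0 ≤ s) (ht : 0 ≤ t) (A B C : Set ℝ)
    (hA : MeasurableSet A) (hB : MeasurableSet B) (hA0 : A.Nonempty) (hB0 : B.Nonempty)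
    (hC : ∀ x ∈ A, ∀ y ∈ B, s * x + t * y ∈ C) :
    ENNReal.ofReal s * volume A + ENNReal.ofReal t * volume B ≤ volume C := by
  have key : ∀ L ⊆ B, IsCompact L → L.Nonempty → 
      ENNReal.ofReal s * volume A + ENNReal.ofReal t * volume L ≤ volume C := by
    intro L hLB hL hL0
    obtain h0 | h0 := eq_or_ne (ENNReal.ofReal s * volume A) 0
    · obtain ⟨a, ha⟩ := hA0
      rw [h0]
      have := bm_compact s t hs ht {a} L C isCompact_singleton hL (by simp) hL0
        (fun x hx y hy => hC x (by simp at hx; simpa [hx]) y (hLB hy))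
      simpa using this
    · have hne : (Set.Iio (ENNReal.ofReal s * volume A)).Nonempty := ⟨0, pos_iff_ne_zero.2 h0⟩
      have hsup : ENNReal.ofReal s * volume A = sSup (Set.Iio (ENNReal.ofReal s * volume A)) := by
        exact sSup_Iio_self _
      rw [hsup, ENNReal.sSup_add hne]
      refine iSup₂_le fun r hr => ?_
      obtain ⟨K, hKA, hK, hK0, hrK⟩ := exists_compact_approx A hA _ r hr (by simp)
      refine le_trans (by gcongr) (bm_compact s t hs ht K L C hK hL hK0 hL0
        (fun x hx y hy => hC x (hKA hx) y (hLB hy)))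
  obtain h0 | h0 := eq_or_ne (ENNReal.ofReal t * volume B) 0
  · obtain ⟨b, hb⟩ := hB0
    rw [h0]
    simpa using key {b} (by simpa) isCompact_singleton (by simp)
  · have hne : (Set.Iio (ENNReal.ofReal t * volume B)).Nonempty := ⟨0, pos_iff_ne_zero.2 h0⟩
    have hsup : ENNReal.ofReal t * volume B = sSup (Set.Iio (ENNReal.ofReal t * volume B)) := by
      exact sSup_Iio_self _
    rw [hsup, add_comm, ENNReal.sSup_add hne]
    refine iSup₂_le fun r hr => ?_
    obtain ⟨L, hLA, hL, hL0, hrL⟩ := exists_compact_approx B hB _ r hr (by simp)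
    rw [add_comm]
    exact le_trans (by gcongr) (key L hLA hL hL0)

theorem pl_core (s t : ℝ) (hs : 0 ≤ s) (ht : 0 ≤ t) (f g h : ℝ → ℝ)
    (hf : Measurable f) (hg : Measurable g) (hh : Measurable h)
    (hf0 : ∀ x, 0 ≤ f x) (hg0 : ∀ x, 0 ≤ g x) (hh0 : ∀ x, 0 ≤ h x)
    (hf1 : ∀ x, f x ≤ 1) (hg1 : ∀ x, g x ≤ 1)
    (hfs : ∀ r < 1, ∃ x, r < f x) (hgs : ∀ r < 1, ∃ x, r < g x)
    (H : ∀ x y r, 0 < r → r < f x → r < g y → r < h (s * x + t * y)) :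
    ENNReal.ofReal s * (∫⁻ x, ENNReal.ofReal (f x)) +
      ENNReal.ofReal t * (∫⁻ x, ENNReal.ofReal (g x))
      ≤ ∫⁻ x, ENNReal.ofReal (h x) := by
  rw [lintegral_eq_lintegral_meas_lt volume (Filter.Eventually.of_forall hf0) hf.aemeasurable,
    lintegral_eq_lintegral_meas_lt volume (Filter.Eventually.of_forall hg0) hg.aemeasurable,
    lintegral_eq_lintegral_meas_lt volume (Filter.Eventually.of_forall hh0) hh.aemeasurable,
    ← lintegral_const_mul' _ _ (by simp), ← lintegral_const_mul' _ _ (by simp)]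
  refine (le_lintegral_add _ _).trans (setLIntegral_mono' measurableSet_Ioi fun r hr => ?_)
  rcases lt_or_ge r 1 with h1 | h1
  · exact bm_one s t hs ht _ _ _ (measurableSet_lt measurable_const hf)
      (measurableSet_lt measurable_const hg) (hfs r h1) (hgs r h1)
      (fun x hx y hy => H x y r hr hx hy)
  · have e1 : {a | r < f a} = ∅ := by
      ext x; simpa using (hf1 x).trans h1
    have e2 : {a | r < g a} = ∅ := by
      ext x; simpa using (hg1 x).trans h1
    simp [e1, e2]

theorem ennreal_amgm (s t : ℝ) (hs : 0 < s) (ht : 0 < t) (hst : s + t = 1) (a b : ℝ≥0∞) :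
    a ^ s * b ^ t ≤ ENNReal.ofReal s * a + ENNReal.ofReal t * b := by
  have hpq : (s⁻¹).HolderConjugate t⁻¹ := by
    rw [Real.holderConjugate_iff]
    refine ⟨(one_lt_inv₀ hs).2 (by linarith), by simpa⟩
  have := ENNReal.young_inequality (a ^ s) (b ^ t) hpq
  rwa [← ENNReal.rpow_mul, ← ENNReal.rpow_mul, mul_inv_cancel₀ hs.ne', mul_inv_cancel₀ ht.ne',
    ENNReal.rpow_one, ENNReal.rpow_one, ENNReal.ofReal_inv_of_pos hs, ENNReal.ofReal_inv_of_pos ht,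
    div_eq_mul_inv, div_eq_mul_inv, inv_inv, inv_inv, mul_comm a, mul_comm b] at this

theorem pl_bounded (s t : ℝ) (hs : 0 < s) (ht : 0 < t) (hst : s + t = 1) (f g h : ℝ → ℝ≥0∞)
    (hf : Measurable f) (hg : Measurable g) (hh : Measurable h)
    (hF : ⨆ x, f x ≠ ∞) (hG : ⨆ x, g x ≠ ∞)
    (H : ∀ x y, f x ^ s * g y ^ t ≤ h (s * x + t * y)) :
    (∫⁻ x, f x) ^ s * (∫⁻ x, g x) ^ t ≤ ∫⁻ x, h x := by
  set F := ⨆ x, f x with hFd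
  set G := ⨆ x, g x with hGd
  have hfF : ∀ x, f x ≤ F := fun x => le_iSup f x
  have hgG : ∀ x, g x ≤ G := fun x => le_iSup g x
  rcases eq_or_ne F 0 with hF0 | hF0
  · have : ∀ x, f x = 0 := fun x => le_antisymm (hF0 ▸ hfF x) bot_le
    simp [this, hs]
  rcases eq_or_ne G 0 with hG0 | hG0
  · have : ∀ x, g x = 0 := fun x => le_antisymm (hG0 ▸ hgG x) bot_le
    simp [this, ht]
  have hsplit : ∀ a b : ℝ≥0∞, (a * F⁻¹) ^ s * (b * G⁻¹) ^ t =
      (a ^ s * b ^ t) * (F ^ s * G ^ t)⁻¹ := by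
    intro a b
    rw [ENNReal.mul_rpow_of_nonneg _ _ hs.le, ENNReal.mul_rpow_of_nonneg _ _ ht.le,
      ENNReal.inv_rpow, ENNReal.inv_rpow, ENNReal.mul_inv]
    · ring
    · left; simp [hF0, hs, hF]
    · left; simp [hF0, hF, hs.le]
  set c := F ^ s * G ^ t with hc
  have hc0 : c ≠ 0 := by simp [hc, hF0, hG0, hF, hG]
  have hct : c ≠ ∞ := ENNReal.mul_ne_top (by simp [hF0, hF, hs.le]) (by simp [hG0, hG, ht.le])
  have hf1 : ∀ x, f x * F⁻¹ ≤ 1 := fun x => by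
    rw [← div_eq_mul_inv]; exact ENNReal.div_le_of_le_mul (by simpa using hfF x)
  have hg1 : ∀ x, g x * G⁻¹ ≤ 1 := fun x => by
    rw [← div_eq_mul_inv]; exact ENNReal.div_le_of_le_mul (by simpa using hgG x)
  have hft : ∀ x, f x * F⁻¹ ≠ ∞ := fun x => ne_top_of_le_ne_top ENNReal.one_ne_top (hf1 x)
  have hgt : ∀ x, g x * G⁻¹ ≠ ∞ := fun x => ne_top_of_le_ne_top ENNReal.one_ne_top (hg1 x)
  have hht : ∀ x, min (h x * c⁻¹) 1 ≠ ∞ := fun x =>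
    ne_top_of_le_ne_top ENNReal.one_ne_top (min_le_right _ _)
  have sup_aux : ∀ (u : ℝ → ℝ≥0∞) (U : ℝ≥0∞), U = ⨆ x, u x → U ≠ 0 → U ≠ ∞ →
      (∀ x, u x * U⁻¹ ≠ ∞) → ∀ r < 1, ∃ x, r < (u x * U⁻¹).toReal := by
    intro u U hU hU0 hUt hut r hr
    rcases lt_or_ge r 0 with h0 | h0
    · exact ⟨0, h0.trans_le ENNReal.toReal_nonneg⟩
    have : ENNReal.ofReal r * U < ⨆ x, u x := by
      rw [← hU]
      calc ENNReal.ofReal r * U < 1 * U := by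
            rw [ENNReal.mul_lt_mul_iff_left hU0 hUt]; simpa using hr
        _ = U := one_mul _
    obtain ⟨x, hx⟩ := lt_iSup_iff.1 this
    refine ⟨x, ?_⟩
    rw [← ENNReal.ofReal_lt_iff_lt_toReal h0 (hut x), ← div_eq_mul_inv]
    rwa [ENNReal.lt_div_iff_mul_lt (Or.inl hU0) (Or.inl hUt)]
  have core := pl_core s t hs.le ht.le (fun x => (f x * F⁻¹).toReal) (fun x => (g x * G⁻¹).toReal)
    (fun x => (min (h x * c⁻¹) 1).toReal) (by fun_prop) (by fun_prop) (by fun_prop)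
    (fun x => ENNReal.toReal_nonneg) (fun x => ENNReal.toReal_nonneg)
    (fun x => ENNReal.toReal_nonneg)
    (fun x => ENNReal.toReal_le_of_le_ofReal zero_le_one (by simpa using hf1 x))
    (fun x => ENNReal.toReal_le_of_le_ofReal zero_le_one (by simpa using hg1 x))
    (sup_aux f F hFd hF0 hF hft) (sup_aux g G hGd hG0 hG hgt) ?_
  · simp only [ENNReal.ofReal_toReal (hft _), ENNReal.ofReal_toReal (hgt _),
      ENNReal.ofReal_toReal (hht _)] at core
    have h2 := (ennreal_amgm s t hs ht hst _ _).trans core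
    rw [lintegral_mul_const _ hf, lintegral_mul_const _ hg, hsplit] at h2
    have h3 : ∫⁻ x, min (h x * c⁻¹) 1 ≤ (∫⁻ x, h x) * c⁻¹ := by
      rw [← lintegral_mul_const _ hh]
      exact lintegral_mono fun x => min_le_left _ _
    have h4 := h2.trans h3
    rwa [ENNReal.mul_le_mul_iff_left (by simpa using hct) (by simpa using hc0)] at h4
  · intro x y r hr hx hy
    have h1 : (f x * F⁻¹) ^ s * (g y * G⁻¹) ^ t ≤ min (h (s * x + t * y) * c⁻¹) 1 := by
      refine le_min ?_ ?_
      · rw [hsplit]; gcongr; exact H x y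
      · exact mul_le_one' (ENNReal.rpow_le_one (hf1 x) hs.le) (ENNReal.rpow_le_one (hg1 y) ht.le)
    have h2 := ENNReal.toReal_mono (hht _) h1
    rw [ENNReal.toReal_mul, ← ENNReal.toReal_rpow, ← ENNReal.toReal_rpow] at h2
    refine lt_of_lt_of_le ?_ h2
    calc r = r ^ s * r ^ t := by rw [← Real.rpow_add hr, hst, Real.rpow_one]
      _ < _ := mul_lt_mul'' (Real.rpow_lt_rpow hr.le hx hs) (Real.rpow_lt_rpow hr.le hy ht)
          (by positivity) (by positivity)

theorem pl_one (s t : ℝ) (hs : 0 < s) (ht : 0 < t) (hst : s + t = 1) (f g h : ℝ → ℝ≥0∞)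
    (hf : Measurable f) (hg : Measurable g) (hh : Measurable h)
    (H : ∀ x y, f x ^ s * g y ^ t ≤ h (s * x + t * y)) :
    (∫⁻ x, f x) ^ s * (∫⁻ x, g x) ^ t ≤ ∫⁻ x, h x := by
  have key : ∀ u : ℝ → ℝ≥0∞, Measurable u →
      Filter.Tendsto (fun n : ℕ => ∫⁻ x, min (u x) n) Filter.atTop (nhds (∫⁻ x, u x)) := by
    intro u hu
    refine lintegral_tendsto_of_tendsto_of_monotone (fun n => by fun_prop) ?_ ?_
    · exact Filter.Eventually.of_forall fun x m n hmn => 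
        min_le_min le_rfl (by exact_mod_cast hmn)
    · refine Filter.Eventually.of_forall fun x => ?_
      have := (tendsto_const_nhds (x := u x)).min ENNReal.tendsto_nat_nhds_top
      simpa using this
  have kf := ((ENNReal.continuous_rpow_const (y := s)).tendsto _).comp (key f hf)
  have kg := ((ENNReal.continuous_rpow_const (y := t)).tendsto _).comp (key g hg)
  have bd : ∀ n : ℕ, (∫⁻ x, min (f x) n) ^ s * (∫⁻ x, min (g x) n) ^ t ≤ ∫⁻ x, h x := by
    intro n
    refine pl_bounded s t hs ht hst _ _ h (by fun_prop) (by fun_prop) hh ?_ ?_ ?_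
    · exact ne_top_of_le_ne_top (ENNReal.natCast_ne_top n) (iSup_le fun x => min_le_right _ _)
    · exact ne_top_of_le_ne_top (ENNReal.natCast_ne_top n) (iSup_le fun x => min_le_right _ _)
    · intro x y
      refine le_trans ?_ (H x y)
      gcongr <;> exact min_le_left _ _
  rcases eq_or_ne (∫⁻ x, f x) 0 with h0 | h0
  · simp [h0, hs]
  rcases eq_or_ne (∫⁻ x, g x) 0 with h0' | h0'
  · simp [h0', ht]
  refine le_of_tendsto (ENNReal.Tendsto.mul kf (Or.inl ?_) kg (Or.inl ?_))
    (Filter.Eventually.of_forall bd)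
  · simp [h0, hs, hs.le, not_lt.2 hs.le]
  · simp [h0', ht, ht.le, not_lt.2 ht.le]

theorem pl_pi (s t : ℝ) (hs : 0 < s) (ht : 0 < t) (hst : s + t = 1) (n : ℕ) :
    ∀ f g h : (Fin n → ℝ) → ℝ≥0∞, 
    Measurable f → Measurable g → Measurable h →
    (∀ x y, f x ^ s * g y ^ t ≤ h (s • x + t • y)) →
    (∫⁻ x, f x) ^ s * (∫⁻ x, g x) ^ t ≤ ∫⁻ x, h x := by
  induction n with
  | zero =>
    intro f g h hf hg hh H
    rw [Measure.volume_pi_eq_dirac 0]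
    simpa [lintegral_dirac' _ hf, lintegral_dirac' _ hg, lintegral_dirac' _ hh] using H 0 0
  | succ n ih =>
    intro f g h hf hg hh H
    let e := (MeasurableEquiv.piFinSuccAbove (fun _ : Fin (n + 1) => ℝ) 0).symm
    have he : MeasurePreserving e := (volume_preserving_piFinSuccAbove (fun _ => ℝ) 0).symm
    have hlin : ∀ (a b : ℝ) (x y : Fin n → ℝ),
        e (s * a + t * b, s • x + t • y) = s • e (a, x) + t • e (b, y) := by
      intro a b x y
      ext i
      refine Fin.cases ?_ (fun j => ?_) i <;>
      simp [e, MeasurableEquiv.piFinSuccAbove]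
    have key : ∀ u : (Fin (n + 1) → ℝ) → ℝ≥0∞, Measurable u →
        ∫⁻ x, u x = ∫⁻ a, ∫⁻ x, u (e (a, x)) := by
      intro u hu
      rw [← he.lintegral_comp hu]
      exact lintegral_prod _ (hu.comp e.measurable).aemeasurable
    rw [key f hf, key g hg, key h hh]
    have hm : ∀ u : (Fin (n + 1) → ℝ) → ℝ≥0∞, Measurable u →
        Measurable fun a => ∫⁻ x, u (e (a, x)) := fun u hu =>
      (hu.comp e.measurable).lintegral_prod_right'
    refine pl_one s t hs ht hst _ _ _ (hm f hf) (hm g hg) (hm h hh) fun a b => ?_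
    refine ih _ _ _ (hf.comp (e.measurable.comp (by fun_prop)))
      (hg.comp (e.measurable.comp (by fun_prop))) (hh.comp (e.measurable.comp (by fun_prop))) ?_
    intro x y
    have := H (e (a, x)) (e (b, y))
    rwa [← hlin] at this

theorem pl_euclid (s t : ℝ) (hs : 0 < s) (ht : 0 < t) (hst : s + t = 1) (n : ℕ)
    (f g h : EuclideanSpace ℝ (Fin n) → ℝ≥0∞)
    (hf : Measurable f) (hg : Measurable g) (hh : Measurable h)
    (H : ∀ x y, f x ^ s * g y ^ t ≤ h (s • x + t • y)) :
    (∫⁻ x, f x) ^ s * (∫⁻ x, g x) ^ t ≤ ∫⁻ x, h x := by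
  have he := PiLp.volume_preserving_toLp (Fin n)
  rw [← he.lintegral_comp hf, ← he.lintegral_comp hg, ← he.lintegral_comp hh]
  refine pl_pi s t hs ht hst n _ _ _ (hf.comp he.measurable) (hg.comp he.measurable)
    (hh.comp he.measurable) fun x y => ?_
  simpa using H (WithLp.toLp 2 x) (WithLp.toLp 2 y)

theorem smoothing_integrable (d : ℕ) (τ κ : ℝ) (hτ : 0 < τ) (hκ : 0 < κ)
    (φ : EuclideanSpace ℝ (Fin d) → ℝ) (hφc : Continuous φ) (hφ : IsStronglyConvex κ φ)
    (y : EuclideanSpace ℝ (Fin d)) :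
    Integrable (fun z => Real.exp (-(‖y - z‖ ^ 2 / (2 * τ)) - φ z)) := by
  have hc : Continuous (fun x => φ x - κ / 2 * ‖x‖ ^ 2) := by fun_prop
  obtain ⟨l, c, hl, -⟩ := ConvexOn.exists_affine_le_of_lt (𝕜 := ℝ) (x := 0)
    (Set.mem_univ _) (sub_one_lt (φ 0 - κ / 2 * ‖(0 : EuclideanSpace ℝ (Fin d))‖ ^ 2))
    isClosed_univ (hc.lowerSemicontinuous.lowerSemicontinuousOn _) hφ
  have hl' : ∀ z, l z + c ≤ φ z - κ / 2 * ‖z‖ ^ 2 := fun z => by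
    simpa using hl ⟨z, Set.mem_univ z⟩
  let w := (InnerProductSpace.toDual ℝ (EuclideanSpace ℝ (Fin d))).symm l
  have hw : ∀ z, inner ℝ w z = l z := fun z => by simp [w]
  have hi := (GaussianFourier.integrable_cexp_neg_mul_sq_norm_add (b := ((κ / 2 : ℝ) : ℂ))
    (by simpa using hκ) (-1) w).norm.const_mul (Real.exp (-c))
  refine hi.mono' (Continuous.aestronglyMeasurable (by fun_prop)) ?_
  refine Filter.Eventually.of_forall fun z => ?_
  rw [Complex.norm_exp, Real.norm_eq_abs, Real.abs_exp, ← Real.exp_add]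
  apply Real.exp_le_exp.2
  have h1 := hl' z
  have h2 : 0 ≤ ‖y - z‖ ^ 2 / (2 * τ) := by positivity
  have h3 : (-((κ / 2 : ℝ) : ℂ) * (‖z‖ : ℂ) ^ 2 + -1 * ((inner ℝ w z : ℝ) : ℂ)).re
      = -(κ / 2) * ‖z‖ ^ 2 - l z := by
    rw [hw]
    have : (-((κ / 2 : ℝ) : ℂ) * (‖z‖ : ℂ) ^ 2 + -1 * ((l z : ℝ) : ℂ))
      = ((-(κ / 2) * ‖z‖ ^ 2 - l z : ℝ) : ℂ) := by push_cast; ring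
    rw [this, Complex.ofReal_re]
  rw [h3]
  linarith

/-- The quadratic part is a perfect square. -/
theorem quad_identity {d : ℕ} (τ κ : ℝ) (hτ : 0 < τ) (hκ : 0 < κ)
    (y z : EuclideanSpace ℝ (Fin d)) :
    ‖y - z‖ ^ 2 / (2 * τ) + κ / 2 * ‖z‖ ^ 2 - κ / (1 + τ * κ) / 2 * ‖y‖ ^ 2
      = (1 + τ * κ) / (2 * τ) * ‖z - (1 / (1 + τ * κ)) • y‖ ^ 2 := by
  have h : (1 + τ * κ) ≠ 0 := by positivity
  rw [norm_sub_sq_real, norm_sub_sq_real, norm_smul, inner_smul_right, mul_pow,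
    Real.norm_eq_abs, sq_abs, real_inner_comm]
  field_simp
  ring

theorem sq_norm_convex {d : ℕ} (s t : ℝ) (hs : 0 ≤ s) (ht : 0 ≤ t) (hst : s + t = 1)
    (u v : EuclideanSpace ℝ (Fin d)) :
    ‖s • u + t • v‖ ^ 2 ≤ s * ‖u‖ ^ 2 + t * ‖v‖ ^ 2 := by
  have h : ConvexOn ℝ Set.univ (fun x : EuclideanSpace ℝ (Fin d) => ‖x‖ ^ 2) :=
    (convexOn_univ_norm).pow (fun _ _ => norm_nonneg _) 2
  simpa using h.2 (Set.mem_univ u) (Set.mem_univ v) hs ht hst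

theorem joint_convex {d : ℕ} (τ κ : ℝ) (hτ : 0 < τ) (hκ : 0 < κ)
    (φ : EuclideanSpace ℝ (Fin d) → ℝ) (hφ : IsStronglyConvex κ φ)
    (s t : ℝ) (hs : 0 ≤ s) (ht : 0 ≤ t) (hst : s + t = 1)
    (y₀ y₁ z₀ z₁ : EuclideanSpace ℝ (Fin d)) (q : EuclideanSpace ℝ (Fin d) →
      EuclideanSpace ℝ (Fin d) → ℝ)
    (hq : ∀ y z, q y z = ‖y - z‖ ^ 2 / (2 * τ) + φ z - κ / (1 + τ * κ) / 2 * ‖y‖ ^ 2) :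
    q (s • y₀ + t • y₁) (s • z₀ + t • z₁) ≤ s * q y₀ z₀ + t * q y₁ z₁ := by
  have hq' : ∀ y z, q y z = (1 + τ * κ) / (2 * τ) * ‖z - (1 / (1 + τ * κ)) • y‖ ^ 2
      + (φ z - κ / 2 * ‖z‖ ^ 2) := by
    intro y z
    rw [hq, ← quad_identity τ κ hτ hκ]; ring
  rw [hq', hq', hq']
  have h1 := hφ.2 (Set.mem_univ z₀) (Set.mem_univ z₁) hs ht hst
  have h2 := sq_norm_convex s t hs ht hst (z₀ - (1 / (1 + τ * κ)) • y₀)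
    (z₁ - (1 / (1 + τ * κ)) • y₁)
  have h3 : s • z₀ + t • z₁ - (1 / (1 + τ * κ)) • (s • y₀ + t • y₁) =
    s • (z₀ - (1 / (1 + τ * κ)) • y₀) + t • (z₁ - (1 / (1 + τ * κ)) • y₁) := by module
  rw [h3]
  have h4 : 0 ≤ (1 + τ * κ) / (2 * τ) := by positivity
  have h5 := mul_le_mul_of_nonneg_left h2 h4
  simp only [smul_eq_mul] at h1
  linarith

theorem gaussian_smoothing_preserves_strong_convexity
    (d : ℕ) (hd : 1 ≤ d)
    (τ κ : ℝ) (hτ : 0 < τ) (hκ : 0 < κ)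
    (φ : EuclideanSpace ℝ (Fin d) → ℝ)
    (hφc : Continuous φ) (hφ : IsStronglyConvex κ φ)
    (G : EuclideanSpace ℝ (Fin d) → ℝ)
    (hG : ∀ y, G y = -Real.log (∫ z, Real.exp (-(‖y - z‖ ^ 2 / (2 * τ)) - φ z))) :
    (∀ y : EuclideanSpace ℝ (Fin d),
      Integrable (fun z => Real.exp (-(‖y - z‖ ^ 2 / (2 * τ)) - φ z)) ∧
      0 < ∫ z, Real.exp (-(‖y - z‖ ^ 2 / (2 * τ)) - φ z)) ∧
    IsStronglyConvex (κ / (1 + τ * κ)) G := by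
  have hint := smoothing_integrable d τ κ hτ hκ φ hφc hφ
  have hpos : ∀ y : EuclideanSpace ℝ (Fin d),
      0 < ∫ z, Real.exp (-(‖y - z‖ ^ 2 / (2 * τ)) - φ z) := fun y => integral_exp_pos (hint y)
  refine ⟨fun y => ⟨hint y, hpos y⟩, ?_⟩
  obtain ⟨q, hq⟩ : ∃ q : EuclideanSpace ℝ (Fin d) → EuclideanSpace ℝ (Fin d) → ℝ,
    ∀ y z, q y z = ‖y - z‖ ^ 2 / (2 * τ) + φ z - κ / (1 + τ * κ) / 2 * ‖y‖ ^ 2 :=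
    ⟨_, fun _ _ => rfl⟩
  have hqc : ∀ y, Continuous (q y) := by
    intro y
    have : q y = fun z => ‖y - z‖ ^ 2 / (2 * τ) + φ z - κ / (1 + τ * κ) / 2 * ‖y‖ ^ 2 :=
      funext (hq y)
    rw [this]; fun_prop
  have hqe : ∀ y z, Real.exp (-q y z) = Real.exp (κ / (1 + τ * κ) / 2 * ‖y‖ ^ 2) *
      Real.exp (-(‖y - z‖ ^ 2 / (2 * τ)) - φ z) := by
    intro y z
    rw [← Real.exp_add, hq]; congr 1; ring
  have hqi : ∀ y, Integrable (fun z => Real.exp (-q y z)) := by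
    intro y
    simp only [hqe]
    exact (hint y).const_mul _
  have hqp : ∀ y, 0 < ∫ z, Real.exp (-q y z) := fun y => integral_exp_pos (hqi y)
  have hGq : ∀ y, G y - κ / (1 + τ * κ) / 2 * ‖y‖ ^ 2 = -Real.log (∫ z, Real.exp (-q y z)) := by
    intro y
    simp only [hqe]
    rw [integral_const_mul, Real.log_mul (Real.exp_pos _).ne' (hpos y).ne', Real.log_exp, hG]
    ring
  refine (convexOn_iff_forall_pos).2 ⟨convex_univ, ?_⟩
  intro y₀ _ y₁ _ s t hs ht hst
  simp only [hGq, smul_eq_mul]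
  have hm : ∀ y, Measurable (fun z => ENNReal.ofReal (Real.exp (-q y z))) := fun y =>
    (Real.continuous_exp.comp (hqc y).neg).measurable.ennreal_ofReal
  have hpl := pl_euclid s t hs ht hst d (fun z => ENNReal.ofReal (Real.exp (-q y₀ z)))
    (fun z => ENNReal.ofReal (Real.exp (-q y₁ z)))
    (fun z => ENNReal.ofReal (Real.exp (-q (s • y₀ + t • y₁) z))) (hm _) (hm _) (hm _) ?_
  · have hof : ∀ y, ∫⁻ z, ENNReal.ofReal (Real.exp (-q y z)) =
        ENNReal.ofReal (∫ z, Real.exp (-q y z)) := fun y =>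
      (ofReal_integral_eq_lintegral_ofReal (hqi y)
        (Filter.Eventually.of_forall fun z => (Real.exp_pos _).le)).symm
    rw [hof, hof, hof, ENNReal.ofReal_rpow_of_pos (hqp _), ENNReal.ofReal_rpow_of_pos (hqp _),
      ← ENNReal.ofReal_mul (Real.rpow_nonneg (hqp _).le _),
      ENNReal.ofReal_le_ofReal_iff (hqp _).le] at hpl
    have hp0 := Real.rpow_pos_of_pos (hqp y₀) s
    have hp1 := Real.rpow_pos_of_pos (hqp y₁) t
    have hlog := Real.log_le_log (mul_pos hp0 hp1) hpl
    rw [Real.log_mul hp0.ne' hp1.ne', Real.log_rpow (hqp _), Real.log_rpow (hqp _)] at hlog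
    linarith
  · intro z₀ z₁
    rw [ENNReal.ofReal_rpow_of_pos (Real.exp_pos _), ENNReal.ofReal_rpow_of_pos (Real.exp_pos _),
      ← ENNReal.ofReal_mul (Real.rpow_nonneg (Real.exp_pos _).le _), ← Real.exp_mul,
      ← Real.exp_mul, ← Real.exp_add]
    apply ENNReal.ofReal_le_ofReal
    apply Real.exp_le_exp.2
    have := joint_convex τ κ hτ hκ φ hφ s t hs.le ht.le hst y₀ y₁ z₀ z₁ q hq
    linarith
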